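/- (Morgan–Scalzo) For each ν ∈ N let K_ν be a compact, convex, nonempty subset of ℝ^{n_ν}, and let θ_ν : ℝ^n → ℝ be pseudo-continuous and quasi-convex with respect to its player's variable. Then there exists x̂ ∈ ∏_{ν∈N} K_ν such that for every ν ∈ N and every y^ν ∈ K_ν, θ_ν(x̂) ≤ θ_ν(y^ν, x̂^{-ν}). -/

import Mathlib

/-- `f` is upper pseudo-continuous. -/
def UpperPseudoContinuous {X : Type*} [TopologicalSpace X] (f : X → ℝ) : Prop :=
  ∀ x y : X, f x < f y → ∃ V ∈ nhds x, ∀ x' ∈ V, f x' < f y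

/-- `f` is pseudo-continuous: both `f` and `-f` are upper pseudo-continuous. -/
def PseudoContinuous {X : Type*} [TopologicalSpace X] (f : X → ℝ) : Prop :=
  UpperPseudoContinuous f ∧ UpperPseudoContinuous (fun x => -f x)

section Cubical

variable {ι : Type*} [DecidableEq ι]

/-- The mod 2 cubical cup product of the coboundaries of the functions `u i`, `i ∈ l`, evaluated
at the cube with lowest vertex `x` and directions `S`. -/
def cupCoboundary (u : ι → (ι → ℕ) → ZMod 2) : List ι → Finset ι → (ι → ℕ) → ZMod 2
  | [], _, _ => 1
  | i :: l, S, x => ∑ s ∈ S, (u i (x + Pi.single s 1) - u i x) *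
      cupCoboundary u l (S.erase s) (x + Pi.single s 1)

theorem sum_erase_eq_zero_of_symm (S : Finset ι) (g : ι → ι → ZMod 2)
    (hg : ∀ s t, g s t = g t s) : ∑ s ∈ S, ∑ t ∈ S.erase s, g s t = 0 := by
  rw [Finset.sum_sigma']
  refine Finset.sum_involution (fun a _ => ⟨a.2, a.1⟩) ?_ ?_ ?_ ?_
  · rintro ⟨s, t⟩ _
    simp only [hg t s]
    exact CharTwo.add_self_eq_zero _
  · rintro ⟨s, t⟩ h _ h'
    simp only [Finset.mem_sigma, Finset.mem_erase, Sigma.mk.injEq, heq_eq_eq] at h h'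
    exact h.2.1 h'.1
  · rintro ⟨s, t⟩ h
    simp only [Finset.mem_sigma, Finset.mem_erase] at h ⊢
    exact ⟨h.2.2, h.2.1.symm, h.1⟩
  · rintro ⟨s, t⟩ _
    rfl

theorem cupCoboundary_cons_of_closed (u : ι → (ι → ℕ) → ZMod 2) (i : ι) (l : List ι)
    (S : Finset ι) (x : ι → ℕ)
    (h : ∑ s ∈ S, (cupCoboundary u l (S.erase s) (x + Pi.single s 1) -
      cupCoboundary u l (S.erase s) x) = 0) :
    cupCoboundary u (i :: l) S x =
      ∑ s ∈ S, (u i (x + Pi.single s 1) * cupCoboundary u l (S.erase s) (x + Pi.single s 1) -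
        u i x * cupCoboundary u l (S.erase s) x) := by
  rw [cupCoboundary, ← sub_eq_zero, ← Finset.sum_sub_distrib, ← mul_zero (-u i x), ← h,
    Finset.mul_sum]
  exact Finset.sum_congr rfl fun s _ => by ring

theorem cupCoboundary_closed (u : ι → (ι → ℕ) → ZMod 2) (l : List ι) (S : Finset ι)
    (x : ι → ℕ) :
    ∑ s ∈ S, (cupCoboundary u l (S.erase s) (x + Pi.single s 1) -
      cupCoboundary u l (S.erase s) x) = 0 := by
  induction l generalizing S x with
  | nil => simp [cupCoboundary]
  | cons i l ih =>
    simp only [cupCoboundary_cons_of_closed u i l _ _ (ih _ _), ← Finset.sum_sub_distrib]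
    refine sum_erase_eq_zero_of_symm S (fun s t => _) fun s t => ?_
    rw [Finset.erase_right_comm, add_right_comm x (Pi.single s 1) (Pi.single t 1)]
    ring

theorem cupCoboundary_cons (u : ι → (ι → ℕ) → ZMod 2) (i : ι) (l : List ι)
    (S : Finset ι) (x : ι → ℕ) :
    cupCoboundary u (i :: l) S x =
      ∑ s ∈ S, (u i (x + Pi.single s 1) * cupCoboundary u l (S.erase s) (x + Pi.single s 1) -
        u i x * cupCoboundary u l (S.erase s) x) :=
  cupCoboundary_cons_of_closed u i l S x (cupCoboundary_closed u l S x)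

theorem cupCoboundary_eq_zero (u : ι → (ι → ℕ) → ZMod 2) {s : ι} {c : ℕ}
    (hu : ∀ x y : ι → ℕ, x s = c → y s = c → u s x = u s y) {l : List ι} (hl : s ∈ l)
    {S : Finset ι} (hS : s ∉ S) {x : ι → ℕ} (hx : x s = c) : cupCoboundary u l S x = 0 := by
  induction l generalizing S x with
  | nil => simp at hl
  | cons i l ih =>
    refine Finset.sum_eq_zero fun t ht => ?_
    have hst : s ≠ t := fun h => hS (h ▸ ht)
    have hx' : (x + Pi.single t 1 : ι → ℕ) s = c := by simp [hst, hx]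
    rcases List.mem_cons.1 hl with rfl | hl
    · rw [hu _ _ hx' hx, sub_self, zero_mul]
    · rw [ih hl (fun h => hS (Finset.mem_of_mem_erase h)) hx', mul_zero]

theorem exists_jump_of_cupCoboundary_ne_zero (u : ι → (ι → ℕ) → ZMod 2) {l : List ι}
    {S : Finset ι} {x : ι → ℕ} (h : cupCoboundary u l S x ≠ 0) {i : ι} (hi : i ∈ l) :
    ∃ y z : ι → ℕ, u i y ≠ u i z ∧ (∀ j, x j ≤ y j ∧ y j ≤ x j + if j ∈ S then 1 else 0) ∧
      ∀ j, x j ≤ z j ∧ z j ≤ x j + if j ∈ S then 1 else 0 := by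
  induction l generalizing S x with
  | nil => simp at hi
  | cons k l ih =>
    obtain ⟨s, hs, hne⟩ := Finset.exists_ne_zero_of_sum_ne_zero h
    have hstep : ∀ j, (x + Pi.single s 1 : ι → ℕ) j = x j + if j = s then 1 else 0 := fun j => by
      simp [Pi.single_apply]
    rcases List.mem_cons.1 hi with rfl | hi
    · refine ⟨x + Pi.single s 1, x, sub_ne_zero.1 (left_ne_zero_of_mul hne), fun j => ?_,
        fun j => by simp⟩
      rw [hstep]
      grind
    · obtain ⟨y, z, hyz, hy, hz⟩ := ih (right_ne_zero_of_mul hne) hi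
      refine ⟨y, z, hyz, fun j => ?_, fun j => ?_⟩
      · have := hy j
        rw [hstep] at this
        grind
      · have := hz j
        rw [hstep] at this
        grind

/-- Sum of `g` over the points agreeing with the argument off `l`, with coordinates in `l`
ranging over `{0, …, p - 1}`. -/
def gridSum (p : ℕ) (g : (ι → ℕ) → ZMod 2) : List ι → (ι → ℕ) → ZMod 2
  | [], x => g x
  | s :: l, x => ∑ k ∈ Finset.range p, gridSum p g l (Function.update x s k)

theorem gridSum_perm (p : ℕ) (g : (ι → ℕ) → ZMod 2) {l l' : List ι} (h : l.Perm l')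
    (x : ι → ℕ) : gridSum p g l x = gridSum p g l' x := by
  induction h generalizing x with
  | nil => rfl
  | cons s _ ih => exact Finset.sum_congr rfl fun k _ => ih _
  | swap s t l =>
    by_cases hst : s = t
    · rw [hst]
    · simp only [gridSum]
      rw [Finset.sum_comm]
      exact Finset.sum_congr rfl fun a _ => Finset.sum_congr rfl fun b _ => by
        rw [Function.update_comm hst]
  | trans _ _ ih₁ ih₂ => exact (ih₁ x).trans (ih₂ x)

theorem gridSum_sum (p : ℕ) {κ : Type*} (A : Finset κ) (g : κ → (ι → ℕ) → ZMod 2)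
    (l : List ι) (x : ι → ℕ) :
    gridSum p (fun y => ∑ a ∈ A, g a y) l x = ∑ a ∈ A, gridSum p (g a) l x := by
  induction l generalizing x with
  | nil => rfl
  | cons s l ih =>
    simp only [gridSum, ih]
    exact Finset.sum_comm

theorem gridSum_diff (p : ℕ) (g : (ι → ℕ) → ZMod 2) {s : ι} {l : List ι} (hs : s ∉ l)
    (x : ι → ℕ) :
    gridSum p (fun y => g (y + Pi.single s 1) - g y) l x =
      gridSum p g l (x + Pi.single s 1) - gridSum p g l x := by
  induction l generalizing x with
  | nil => rfl
  | cons t l ih =>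
    have hst : s ≠ t := fun h => hs (h ▸ List.mem_cons_self)
    simp only [gridSum, ih fun h => hs (List.mem_cons_of_mem _ h), Finset.sum_sub_distrib]
    congr 1
    refine Finset.sum_congr rfl fun k _ => congrArg _ ?_
    ext j
    by_cases hj : j = t
    · subst hj; simp [hst.symm]
    · simp [hj]

theorem gridSum_cons_diff (p : ℕ) (g : (ι → ℕ) → ZMod 2) {s : ι} {l : List ι} (hs : s ∉ l)
    (x : ι → ℕ) :
    gridSum p (fun y => g (y + Pi.single s 1) - g y) (s :: l) x =
      gridSum p g l (Function.update x s p) - gridSum p g l (Function.update x s 0) := by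
  simp only [gridSum, gridSum_diff p g hs]
  rw [← Finset.sum_range_sub fun k => gridSum p g l (Function.update x s k)]
  refine Finset.sum_congr rfl fun k _ => ?_
  congr 2
  ext j
  by_cases hj : j = s
  · subst hj; simp
  · simp [hj]

theorem gridSum_congr (p : ℕ) {g g' : (ι → ℕ) → ZMod 2} {l : List ι} {x : ι → ℕ}
    (h : ∀ y : ι → ℕ, (∀ j ∉ l, y j = x j) → g y = g' y) :
    gridSum p g l x = gridSum p g' l x := by
  induction l generalizing x with
  | nil => exact h x fun _ _ => rfl
  | cons s l ih =>
    refine Finset.sum_congr rfl fun k _ => ih fun y hy => h y fun j hj => ?_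
    rw [List.mem_cons, not_or] at hj
    rw [hy j hj.2, Function.update_of_ne hj.1]

theorem gridSum_zero (p : ℕ) (l : List ι) (x : ι → ℕ) :
    gridSum p (fun _ => 0) l x = 0 := by
  induction l generalizing x with
  | nil => rfl
  | cons s l ih => exact Finset.sum_eq_zero fun k _ => ih _

theorem exists_of_gridSum_ne_zero {p : ℕ} {g : (ι → ℕ) → ZMod 2} {l : List ι} {x : ι → ℕ}
    (h : gridSum p g l x ≠ 0) :
    ∃ y : ι → ℕ, g y ≠ 0 ∧ ∀ j, y j < p ∨ (j ∉ l ∧ y j = x j) := by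
  induction l generalizing x with
  | nil => exact ⟨x, h, fun j => Or.inr ⟨by simp, rfl⟩⟩
  | cons s l ih =>
    obtain ⟨k, hk, hne⟩ := Finset.exists_ne_zero_of_sum_ne_zero h
    obtain ⟨y, hy, hy'⟩ := ih hne
    refine ⟨y, hy, fun j => ?_⟩
    have hk' := Finset.mem_range.1 hk
    have h1 := hy' j
    by_cases hj : j = s
    · subst hj
      simp only [Function.update_self] at h1
      grind
    · simp only [Function.update_of_ne hj] at h1
      grind

theorem gridSum_cupCoboundary (p : ℕ) (u : ι → (ι → ℕ) → ZMod 2)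
    (h0 : ∀ i x, x i = 0 → u i x = 0) (hp : ∀ i x, x i = p → u i x = 1) {l : List ι}
    (hl : l.Nodup) (x : ι → ℕ) : gridSum p (cupCoboundary u l l.toFinset) l x = 1 := by
  induction l generalizing x with
  | nil => rfl
  | cons i l ih =>
    rw [List.nodup_cons] at hl
    have hterm : ∀ s ∈ (i :: l).toFinset,
        gridSum p (fun y => u i (y + Pi.single s 1) *
            cupCoboundary u l ((i :: l).toFinset.erase s) (y + Pi.single s 1) -
          u i y * cupCoboundary u l ((i :: l).toFinset.erase s) y) (i :: l) x =
        if s = i then 1 else 0 := by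
      intro s hs
      rw [List.mem_toFinset] at hs
      have hnot : s ∉ (i :: l).erase s :=
        fun h => (List.Nodup.mem_erase_iff (List.nodup_cons.2 hl)).1 h |>.1 rfl
      rw [gridSum_perm p _ (List.perm_cons_erase hs),
        gridSum_cons_diff p
          (fun y => u i y * cupCoboundary u l ((i :: l).toFinset.erase s) y) hnot]
      split_ifs with hsi
      · subst hsi
        have he : (s :: l).toFinset.erase s = l.toFinset := by
          rw [List.toFinset_cons, Finset.erase_insert (by simpa using hl.1)]
        rw [List.erase_cons_head, he,
          gridSum_congr p (g' := cupCoboundary u l l.toFinset) (x := Function.update x s p),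
          gridSum_congr p (g' := fun _ => 0) (x := Function.update x s 0), gridSum_zero,
          ih hl.2, sub_zero]
        · intro y hy
          rw [h0 s y (by simpa using hy s hl.1), zero_mul]
        · intro y hy
          rw [hp s y (by simpa using hy s hl.1), one_mul]
      · have hsl : s ∈ l := (List.mem_cons.1 hs).resolve_left hsi
        rw [gridSum_congr p (g' := fun _ => 0) (x := Function.update x s p),
          gridSum_congr p (g' := fun _ => 0) (x := Function.update x s 0), gridSum_zero,
          gridSum_zero, sub_zero]
        · intro y hy
          rw [cupCoboundary_eq_zero u (c := 0) (fun a b ha hb => by rw [h0 s a ha, h0 s b hb])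
            hsl (Finset.notMem_erase _ _) (by simpa using hy s hnot), mul_zero]
        · intro y hy
          rw [cupCoboundary_eq_zero u (c := p) (fun a b ha hb => by rw [hp s a ha, hp s b hb])
            hsl (Finset.notMem_erase _ _) (by simpa using hy s hnot), mul_zero]
    rw [gridSum_congr p fun y _ => cupCoboundary_cons u i l _ y, gridSum_sum,
      Finset.sum_congr rfl hterm]
    simp

/-- **Kuhn's cubical lemma**. -/
theorem exists_cube_forall_label_ne [Fintype ι] (p : ℕ) (u : ι → (ι → ℕ) → ZMod 2)
    (h0 : ∀ i x, x i = 0 → u i x = 0) (hp : ∀ i x, x i = p → u i x = 1) :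
    ∃ x : ι → ℕ, (∀ j, x j < p) ∧ ∀ i, ∃ y z : ι → ℕ, u i y ≠ u i z ∧
      (∀ j, x j ≤ y j ∧ y j ≤ x j + 1) ∧ ∀ j, x j ≤ z j ∧ z j ≤ x j + 1 := by
  obtain ⟨x, hx, hxp⟩ := exists_of_gridSum_ne_zero (x := 0) (by
    rw [gridSum_cupCoboundary p u h0 hp (Finset.nodup_toList Finset.univ)]
    exact one_ne_zero)
  refine ⟨x, fun j => (hxp j).resolve_right (by simp), fun i => ?_⟩
  simpa using exists_jump_of_cupCoboundary_ne_zero u hx (i := i) (by simp)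

end Cubical

/-- **Brouwer's fixed point theorem** on the unit cube. -/
theorem exists_fixedPoint_of_mem_Ioo {ι : Type*} [Fintype ι] (F : (ι → ℝ) → ι → ℝ)
    (hF : Continuous F) (h : ∀ x i, F x i ∈ Set.Ioo (0 : ℝ) 1) : ∃ x, F x = x := by
  classical
  by_contra! hne
  let c : ι × Bool → Set (ι → ℝ) := fun a =>
    if a.2 then {x | F x a.1 < x a.1} else {x | x a.1 < F x a.1}
  have hc : ∀ a, IsOpen (c a) := by
    rintro ⟨i, b⟩
    cases b
    · exact isOpen_lt (by fun_prop) (by fun_prop)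
    · exact isOpen_lt (by fun_prop) (by fun_prop)
  obtain ⟨δ, hδ, hball⟩ := lebesgue_number_lemma_of_metric
    (isCompact_Icc (a := (0 : ι → ℝ)) (b := 1)) hc (fun x _ => by
      obtain ⟨i, hi⟩ := Function.ne_iff.1 (hne x)
      rcases lt_or_gt_of_ne hi with hi | hi
      · exact Set.mem_iUnion.2 ⟨(i, true), by simpa [c] using hi⟩
      · exact Set.mem_iUnion.2 ⟨(i, false), by simpa [c] using hi⟩)
  obtain ⟨m, hm⟩ := exists_nat_one_div_lt hδ
  let φ : (ι → ℕ) → ι → ℝ := fun x i => x i / (m + 1 : ℝ)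
  have hm0 : (0 : ℝ) < m + 1 := by positivity
  obtain ⟨x, hx, hx'⟩ := exists_cube_forall_label_ne (m + 1)
    (fun i (x : ι → ℕ) => if F (φ x) i < φ x i then (1 : ZMod 2) else 0)
    (fun i x hi => if_neg (by simpa [φ, hi] using (h (φ x) i).1.le))
    (fun i x hi => if_pos (by
      have : φ x i = 1 := by simp only [φ, hi]; push_cast; exact div_self hm0.ne'
      rw [this]; exact (h (φ x) i).2))
  obtain ⟨⟨i, b⟩, hib⟩ := hball (φ x) ⟨fun j => by simp only [φ, Pi.zero_apply]; positivity,
    fun j => by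
      have : (x j : ℝ) ≤ m + 1 := by exact_mod_cast (hx j).le
      simpa [φ] using (div_le_one hm0).2 this⟩
  have hnear : ∀ y : ι → ℕ, (∀ j, x j ≤ y j ∧ y j ≤ x j + 1) → φ y ∈ c (i, b) := by
    refine fun y hy => hib ?_
    rw [Metric.mem_ball]
    refine lt_of_le_of_lt ((dist_pi_le_iff (by positivity)).2 fun j => ?_) hm
    have h1 : (x j : ℝ) ≤ y j := by exact_mod_cast (hy j).1
    have h2 : (y j : ℝ) ≤ x j + 1 := by exact_mod_cast (hy j).2
    rw [Real.dist_eq, ← sub_div, abs_of_nonneg (div_nonneg (by linarith) hm0.le)]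
    gcongr
    linarith
  obtain ⟨y, z, hyz, hy, hz⟩ := hx' i
  have hy := hnear y hy
  have hz := hnear z hz
  cases b
  · simp only [c, Bool.false_eq_true, if_false, Set.mem_ofPred_eq] at hy hz
    exact hyz (by rw [if_neg hy.not_gt, if_neg hz.not_gt])
  · simp only [c, if_true, Set.mem_ofPred_eq] at hy hz
    exact hyz (by rw [if_pos hy, if_pos hz])

/-- The metric projection onto a closed convex set is a continuous retraction. -/
theorem Convex.exists_continuous_retraction {E : Type*} [NormedAddCommGroup E]
    [InnerProductSpace ℝ E] {K : Set E} (hne : K.Nonempty) (hK : IsComplete K)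
    (hconv : Convex ℝ K) :
    ∃ P : E → E, Continuous P ∧ (∀ x, P x ∈ K) ∧ ∀ x ∈ K, P x = x := by
  choose P hPK hP using exists_norm_eq_iInf_of_complete_convex hne hK hconv
  have hin : ∀ x, ∀ w ∈ K, inner ℝ (x - P x) (w - P x) ≤ 0 := fun x =>
    (norm_eq_iInf_iff_real_inner_le_zero hconv (hPK x)).1 (hP x)
  refine ⟨P, ?_, hPK, fun x hx => ?_⟩
  · refine (LipschitzWith.of_dist_le_mul (K := 1) fun x y => ?_).continuous
    rw [dist_eq_norm, dist_eq_norm, NNReal.coe_one, one_mul]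
    have h1 := hin x _ (hPK y)
    have h2 := hin y _ (hPK x)
    have h3 : inner ℝ (x - y) (P x - P y) = inner ℝ (P x - P y) (P x - P y)
        - inner ℝ (x - P x) (P y - P x) - inner ℝ (y - P y) (P x - P y) := by
      rw [← neg_sub (P x) (P y), inner_neg_right, sub_neg_eq_add, ← inner_add_left,
        ← inner_sub_left]
      congr 1
      abel
    have h4 := real_inner_le_norm (x - y) (P x - P y)
    rw [real_inner_self_eq_norm_sq] at h3
    by_contra! hlt
    nlinarith [norm_nonneg (x - y)]
  · have := hin x x hx
    rw [real_inner_self_eq_norm_sq] at this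
    have h0 : ‖x - P x‖ = 0 := by nlinarith [norm_nonneg (x - P x)]
    exact (sub_eq_zero.1 (norm_eq_zero.1 h0)).symm

/-- **Brouwer's fixed point theorem** for products of compact convex sets. -/
theorem exists_fixedPoint_of_mapsTo_pi {N : Type*} [Fintype N] {n : N → ℕ}
    (K : ∀ ν : N, Set (EuclideanSpace ℝ (Fin (n ν))))
    (hKcomp : ∀ ν, IsCompact (K ν)) (hKconv : ∀ ν, Convex ℝ (K ν))
    (hKne : ∀ ν, (K ν).Nonempty)
    (f : (∀ ν : N, EuclideanSpace ℝ (Fin (n ν))) → ∀ ν : N, EuclideanSpace ℝ (Fin (n ν)))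
    (hf : Continuous f) (hfK : ∀ x, (∀ ν, x ν ∈ K ν) → ∀ ν, f x ν ∈ K ν) :
    ∃ x, (∀ ν, x ν ∈ K ν) ∧ f x = x := by
  choose P hPc hPK hP using fun ν =>
    (hKconv ν).exists_continuous_retraction (hKne ν) (hKcomp ν).isComplete
  obtain ⟨R, hR0, hR⟩ : ∃ R : ℝ, 0 < R ∧ ∀ x : ∀ ν, EuclideanSpace ℝ (Fin (n ν)),
      (∀ ν, x ν ∈ K ν) → ∀ ν k, |x ν k| < R := by
    obtain ⟨R, hR0, hR⟩ := (isCompact_univ_pi hKcomp).isBounded.exists_pos_norm_lt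
    refine ⟨R, hR0, fun x hx ν k => ?_⟩
    exact ((PiLp.norm_apply_le (x ν) k).trans (norm_le_pi_norm x ν)).trans_lt
      (hR x fun ν _ => hx ν)
  let g : ((Σ ν, Fin (n ν)) → ℝ) → ∀ ν, EuclideanSpace ℝ (Fin (n ν)) := fun z ν =>
    P ν (WithLp.toLp 2 fun k => (2 * z ⟨ν, k⟩ - 1) * R)
  have hg : Continuous g := continuous_pi fun ν => (hPc ν).comp
    ((PiLp.continuous_toLp 2 _).comp (by fun_prop))
  have hfg : ∀ z ν, f (g z) ν ∈ K ν := fun z => hfK _ fun ν => hPK ν _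
  obtain ⟨z, hz⟩ := exists_fixedPoint_of_mem_Ioo
    (fun z (a : Σ ν, Fin (n ν)) => (f (g z) a.1 a.2 / R + 1) / 2)
    (by
      have : Continuous fun z => f (g z) := hf.comp hg
      fun_prop)
    (fun z a => by
      have h1 := abs_lt.1 (hR _ (hfg z) a.1 a.2)
      have h2 : f (g z) a.1 a.2 / R < 1 := (div_lt_one hR0).2 h1.2
      have h3 : -1 < f (g z) a.1 a.2 / R := by rw [lt_div_iff₀ hR0]; linarith [h1.1]
      constructor <;> linarith)
  have hfix : f (g z) = g z := by
    funext ν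
    have : (WithLp.toLp 2 fun k => (2 * z ⟨ν, k⟩ - 1) * R) = f (g z) ν := by
      ext k
      have h1 : (f (g z) ν k / R + 1) / 2 = z ⟨ν, k⟩ := congrFun hz ⟨ν, k⟩
      simp only [← h1]
      field_simp
      ring
    change _ = P ν _
    rw [this, hP ν _ (hfg z ν)]
  exact ⟨g z, fun ν => hPK ν _, hfix⟩

theorem UpperPseudoContinuous.isOpen_lt {X : Type*} [TopologicalSpace X] {f : X → ℝ}
    (hf : UpperPseudoContinuous f) (y : X) : IsOpen {x | f x < f y} :=
  isOpen_iff_mem_nhds.2 fun x hx =>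
    let ⟨_, hV, hVf⟩ := hf x y hx
    Filter.mem_of_superset hV hVf

theorem PseudoContinuous.isOpen_gt {X : Type*} [TopologicalSpace X] {f : X → ℝ}
    (hf : PseudoContinuous f) (y : X) : IsOpen {x | f y < f x} := by
  simpa using hf.2.isOpen_lt y

theorem PseudoContinuous.isOpen_comp_lt {X : Type*} [TopologicalSpace X] [PreconnectedSpace X]
    {f : X → ℝ} (hf : PseudoContinuous f) {g : X → X} (hg : Continuous g) :
    IsOpen {x | f (g x) < f x} := by
  refine isOpen_iff_mem_nhds.2 fun x hx => ?_
  change f (g x) < f x at hx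
  by_cases hw : ∃ w, f (g x) < f w ∧ f w < f x
  · obtain ⟨w, h1, h2⟩ := hw
    filter_upwards [((hf.1.isOpen_lt w).preimage hg).mem_nhds h1, (hf.isOpen_gt w).mem_nhds h2]
      with x' h1' h2' using lt_trans h1' h2'
  · push Not at hw
    have hclopen : IsClopen {y | f y < f x} := by
      refine ⟨⟨?_⟩, hf.1.isOpen_lt x⟩
      convert hf.isOpen_gt (g x) using 1
      ext y
      simp only [Set.mem_compl_iff, Set.mem_ofPred_eq, not_lt]
      exact ⟨fun h => hx.trans_le h, hw y⟩
    rcases isClopen_iff.1 hclopen with h | h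
    · exact absurd (show g x ∈ {y | f y < f x} from hx) (by rw [h]; simp)
    · exact absurd (show x ∈ {y | f y < f x} by rw [h]; trivial) (by simp)

/-- **(Morgan–Scalzo)** If each strategy set `K ν ⊆ ℝ^{n_ν}` is compact, convex and
nonempty, and each objective function `θ ν` is pseudo-continuous and quasi-convex with
respect to its player's variable, then the game admits a Nash equilibrium. -/
theorem morgan_scalzo_existence
    {N : Type*} [Fintype N] [Nonempty N] [DecidableEq N] {n : N → ℕ}
    (K : ∀ ν : N, Set (EuclideanSpace ℝ (Fin (n ν))))
    (hKcomp : ∀ ν, IsCompact (K ν)) (hKconv : ∀ ν, Convex ℝ (K ν))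
    (hKne : ∀ ν, (K ν).Nonempty)
    (θ : ∀ _ : N, (∀ ν : N, EuclideanSpace ℝ (Fin (n ν))) → ℝ)
    (hpc : ∀ ν, PseudoContinuous (θ ν))
    (hqc : ∀ (ν : N) (x : ∀ ν : N, EuclideanSpace ℝ (Fin (n ν))),
      ∀ y z : EuclideanSpace ℝ (Fin (n ν)), ∀ t ∈ Set.Icc (0:ℝ) 1,
        θ ν (Function.update x ν (t • y + (1 - t) • z)) ≤
          max (θ ν (Function.update x ν y)) (θ ν (Function.update x ν z))) :
    ∃ xhat : ∀ ν : N, EuclideanSpace ℝ (Fin (n ν)),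
      (∀ ν, xhat ν ∈ K ν) ∧
      ∀ ν : N, ∀ y ∈ K ν, θ ν xhat ≤ θ ν (Function.update xhat ν y) := by
  by_contra! hno
  let U : (Σ ν, EuclideanSpace ℝ (Fin (n ν))) → Set (∀ ν, EuclideanSpace ℝ (Fin (n ν))) :=
    fun p => {x | θ p.1 (Function.update x p.1 p.2) < θ p.1 x}
  have hU : ∀ p, IsOpen (U p) := fun p =>
    (hpc p.1).isOpen_comp_lt (continuous_id.update p.1 continuous_const)
  have hUne : ∀ p, (U p)ᶜ.Nonempty := fun p => ⟨Function.update 0 p.1 p.2, by simp [U]⟩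
  obtain ⟨t, ht⟩ := (isCompact_univ_pi hKcomp).elim_finite_subcover
    (fun p : {p : Σ ν, EuclideanSpace ℝ (Fin (n ν)) // p.2 ∈ K p.1} => U p)
    (fun p => hU p) (fun x hx => by
      obtain ⟨ν, y, hy, hlt⟩ := hno x fun ν => hx ν trivial
      exact Set.mem_iUnion.2 ⟨⟨⟨ν, y⟩, hy⟩, hlt⟩)
  let β := fun (p : {p : Σ ν, EuclideanSpace ℝ (Fin (n ν)) // p.2 ∈ K p.1}) x =>
    Metric.infDist x (U p)ᶜ
  have hβ0 : ∀ p x, 0 ≤ β p x := fun p x => Metric.infDist_nonneg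
  have hβc : ∀ p, Continuous (β p) := fun p => Metric.continuous_infDist_pt _
  have hβU : ∀ p x, 0 < β p x ↔ x ∈ U p := fun p x => by
    rw [← (hU p).isClosed_compl.notMem_iff_infDist_pos (hUne p), Set.notMem_compl_iff]
  have hsum : ∀ x, 0 < 1 + ∑ p ∈ t, β p x := fun x =>
    add_pos_of_pos_of_nonneg one_pos (Finset.sum_nonneg fun p _ => hβ0 p x)
  obtain ⟨x, hxK, hx⟩ := exists_fixedPoint_of_mapsTo_pi K hKcomp hKconv hKne
    (fun x => (1 + ∑ p ∈ t, β p x)⁻¹ •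
      (x + ∑ p ∈ t, β p x • Function.update x p.1.1 p.1.2))
    (((continuous_const.add (continuous_finsetSum _ fun p _ => hβc p)).inv₀
      fun x => (hsum x).ne').smul (continuous_id.add (continuous_finsetSum _ fun p _ =>
        (hβc p).smul (continuous_id.update p.1.1 continuous_const))))
    (fun x hx ν => by
      have hupd : ∀ p : {p : Σ ν, EuclideanSpace ℝ (Fin (n ν)) // p.2 ∈ K p.1},
          Function.update x p.1.1 p.1.2 ν ∈ K ν := by
        rintro ⟨⟨μ, y⟩, hy⟩
        by_cases h : ν = μ
        · subst h; simpa using hy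
        · simpa [h] using hx ν
      have := (hKconv ν).centerMass_mem (t := Finset.insertNone t)
        (w := fun o => o.elim 1 fun p => β p x)
        (z := fun o => o.elim (x ν) fun p => Function.update x p.1.1 p.1.2 ν)
        (by rintro (_ | p) _ <;> simp [hβ0]) (by simpa using hsum x)
        (by rintro (_ | p) _ <;> simp [hx, hupd])
      simpa [Finset.centerMass] using this)
  have hx' : ∑ p ∈ t, β p x • (Function.update x p.1.1 p.1.2 - x) = 0 := by
    rw [inv_smul_eq_iff₀ (hsum x).ne', add_smul, one_smul, add_right_inj, Finset.sum_smul] at hx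
    simp only [smul_sub, Finset.sum_sub_distrib, hx, sub_self]
  obtain ⟨p₀, hp₀, hxp₀⟩ := Set.mem_iUnion₂.1 (ht fun ν _ => hxK ν)
  set ν := p₀.1.1
  have hconv : Convex ℝ {y | θ ν (Function.update x ν y) < θ ν x} := by
    intro y hy z hz a b ha hb hab
    obtain rfl : b = 1 - a := by linarith
    exact (hqc ν x y z a ⟨ha, by linarith⟩).trans_lt (max_lt hy hz)
  let s := t.filter fun p => p.1.1 = ν ∧ 0 < β p x
  have hs : 0 < ∑ p ∈ s, β p x := Finset.sum_pos (fun p hp => (Finset.mem_filter.1 hp).2.2)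
    ⟨p₀, Finset.mem_filter.2 ⟨hp₀, rfl, (hβU _ _).2 hxp₀⟩⟩
  have hmem := hconv.centerMass_mem (t := s) (w := fun p => β p x)
    (z := fun p => Function.update x p.1.1 p.1.2 ν) (fun p _ => hβ0 p x) hs (by
      rintro ⟨⟨μ, y⟩, hy⟩ hp
      obtain ⟨-, hμ, hpos⟩ := Finset.mem_filter.1 hp
      have hlt := (hβU _ _).1 hpos
      change μ = ν at hμ
      clear_value ν
      subst hμ
      simpa [U] using hlt)
  have hcm : s.centerMass (fun p => β p x) (fun p => Function.update x p.1.1 p.1.2 ν) = x ν := by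
    rw [Finset.centerMass, inv_smul_eq_iff₀ hs.ne', ← sub_eq_zero, Finset.sum_smul,
      ← Finset.sum_sub_distrib]
    have h0 := congrFun hx' ν
    rw [Finset.sum_apply] at h0
    refine Eq.trans (Finset.sum_subset (Finset.filter_subset _ _) fun p hp hps => ?_)
      (Eq.trans (Finset.sum_congr rfl fun p _ => ?_) h0)
    · by_cases hpν : p.1.1 = ν
      · have : β p x = 0 := le_antisymm
          (not_lt.1 fun h => hps (Finset.mem_filter.2 ⟨hp, hpν, h⟩)) (hβ0 p x)
        simp [this]
      · rw [Function.update_of_ne (Ne.symm hpν), sub_self]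
    · rw [← smul_sub]; rfl
  rw [hcm] at hmem
  simp at hmem
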